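/- arXiv:1611.07830 — 2 statements merged into one kernel-verified Lean document; each statement's English description precedes it below -/
import Mathlib

section
/- Let ρ be a c-compatible irreducible representation of ℂl(V) on a finite-dimensional complex vector space K with Krein product (·,·). Then Q has anti-Lorentzian signature (1, n−1) if and only if there exists v ∈ V, invertible in ℂl(V), such that the hermitian form (ψ,φ)_v := (ψ, ρ(v)⁻¹φ) on K is definite (positive or negative definite). Moreover, when Q is anti-Lorentzian, with open light cone C := {v ∈ V : Q(v) > 0} and its two connected components C₊ and C₋: for every v ∈ V with Q(v) ≠ 0, the form (·,·)_v is definite if and only if v ∈ C, and there exists a sign λ ∈ {+1, −1} such that for v ∈ C, λ(·,·)_v is positive definite if and only if v ∈ C₊ and λ(·,·)_v is negative definite if and only if v ∈ C₋. -/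
noncomputable section

open TensorProduct

variable {V : Type*} [AddCommGroup V] [Module ℝ V]

/-- `ℂl(V)`: the complexified Clifford algebra of `(V, Q)` (convention `v² = Q(v)·1`). -/
abbrev CCl (Q : QuadraticForm ℝ V) := CliffordAlgebra (Q.baseChange ℂ)

/-- The canonical embedding of the real vector space `V` into `ℂl(V)`. -/
def ιr (Q : QuadraticForm ℝ V) (v : V) : CCl Q :=
  CliffordAlgebra.ι (Q.baseChange ℂ) ((1 : ℂ) ⊗ₜ[ℝ] v)

/-- `V^ℂ`: the complexification of `V`, sitting inside `ℂl(V)`. -/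
def VC (Q : QuadraticForm ℝ V) : Submodule ℂ (CCl Q) :=
  LinearMap.range (CliffordAlgebra.ι (Q.baseChange ℂ))

/-- A real structure on `ℂl(V)`: an involutive conjugate-linear algebra automorphism
stabilizing `V^ℂ`. -/
structure RealStructure (Q : QuadraticForm ℝ V) where
  toFun : CCl Q → CCl Q
  map_add' : ∀ x y, toFun (x + y) = toFun x + toFun y
  map_mul' : ∀ x y, toFun (x * y) = toFun x * toFun y
  map_smul' : ∀ (z : ℂ) (x : CCl Q), toFun (z • x) = (starRingEnd ℂ z) • toFun x
  map_one' : toFun 1 = 1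
  invol : ∀ x, toFun (toFun x) = x
  stable : ∀ x ∈ VC Q, toFun x ∈ VC Q

namespace RealStructure

theorem map_zero' {Q : QuadraticForm ℝ V} (σ : RealStructure Q) : σ.toFun 0 = 0 := by
  have h := σ.map_smul' 0 0
  simpa using h

end RealStructure

/-- The fixed points of a real structure, as a real submodule of `ℂl(V)`. -/
def fixedPoints {Q : QuadraticForm ℝ V} (σ : RealStructure Q) : Submodule ℝ (CCl Q) where
  carrier := {x | σ.toFun x = x}
  add_mem' := by
    intro a b ha hb
    simp only [Set.mem_setOf_eq] at *
    rw [σ.map_add', ha, hb]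
  zero_mem' := σ.map_zero'
  smul_mem' := by
    intro r x hx
    simp only [Set.mem_setOf_eq] at *
    rw [← Complex.coe_smul, σ.map_smul', hx]
    simp [Complex.conj_ofReal]

/-- `V_σ = {w ∈ V^ℂ : σ(w) = w}`, as a real submodule of `ℂl(V)`. -/
def VFix {Q : QuadraticForm ℝ V} (σ : RealStructure Q) : Submodule ℝ (CCl Q) :=
  (VC Q).restrictScalars ℝ ⊓ fixedPoints σ

/-- Multiplication by `i`, as a real-linear endomorphism of `ℂl(V)`. -/
def mulI (Q : QuadraticForm ℝ V) : CCl Q →ₗ[ℝ] CCl Q where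
  toFun x := Complex.I • x
  map_add' x y := smul_add _ x y
  map_smul' r x := smul_comm Complex.I r x

/-- The real subspace `V ⊆ V^ℂ ⊆ ℂl(V)`. -/
def Vreal (Q : QuadraticForm ℝ V) : Submodule ℝ (CCl Q) :=
  Submodule.span ℝ (Set.range (ιr Q))

/-- The canonical real structure `c` (characterized by fixing `V` pointwise). -/
def IsCanonicalC {Q : QuadraticForm ℝ V} (c : RealStructure Q) : Prop :=
  ∀ v : V, c.toFun (ιr Q v) = ιr Q v

/-- `σ` is admissible iff it commutes with the canonical real structure `c`. -/
def Admissible {Q : QuadraticForm ℝ V} (c σ : RealStructure Q) : Prop :=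
  ∀ x, σ.toFun (c.toFun x) = c.toFun (σ.toFun x)

/-- Nondegeneracy of a real quadratic form, via its polar form. -/
def QFNondeg (Q : QuadraticForm ℝ V) : Prop :=
  ∀ v : V, (∀ w : V, QuadraticMap.polar Q v w = 0) → v = 0

/-- A hermitian sesquilinear form (conjugate-linear in the first argument). -/
structure SesqForm (K : Type*) [AddCommGroup K] [Module ℂ K] where
  form : K → K → ℂ
  add_left : ∀ x y z : K, form (x + y) z = form x z + form y z
  add_right : ∀ x y z : K, form x (y + z) = form x y + form x z
  smul_left : ∀ (a : ℂ) (x y : K), form (a • x) y = starRingEnd ℂ a * form x y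
  smul_right : ∀ (a : ℂ) (x y : K), form x (a • y) = a * form x y
  herm : ∀ x y : K, form y x = starRingEnd ℂ (form x y)

section KreinDefs

variable {K : Type*} [AddCommGroup K] [Module ℂ K]

/-- Nondegeneracy: a nondegenerate hermitian form is a Krein product. -/
def SesqForm.Nondeg (h : SesqForm K) : Prop :=
  ∀ x : K, (∀ y : K, h.form x y = 0) → x = 0

/-- Positive definiteness of a sesquilinear form. -/
def FPosDef (f : K → K → ℂ) : Prop := ∀ x : K, x ≠ 0 → ∃ r : ℝ, 0 < r ∧ f x x = r

/-- Negative definiteness of a sesquilinear form. -/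
def FNegDef (f : K → K → ℂ) : Prop := ∀ x : K, x ≠ 0 → ∃ r : ℝ, r < 0 ∧ f x x = r

/-- Definiteness of a sesquilinear form. -/
def FDefinite (f : K → K → ℂ) : Prop := FPosDef f ∨ FNegDef f

/-- `f` is neutral: it admits an orthogonal decomposition into a positive definite
and a negative definite part of equal dimensions (equal indices of inertia). -/
def FNeutral (f : K → K → ℂ) : Prop :=
  ∃ P N : Submodule ℂ K, P ⊓ N = ⊥ ∧ P ⊔ N = ⊤
    ∧ (∀ x ∈ P, ∀ y ∈ N, f x y = 0)
    ∧ (∀ x ∈ P, x ≠ 0 → ∃ r : ℝ, 0 < r ∧ f x x = r)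
    ∧ (∀ y ∈ N, y ≠ 0 → ∃ r : ℝ, r < 0 ∧ f y y = r)
    ∧ Module.finrank ℂ P = Module.finrank ℂ N

end KreinDefs

section Rep

variable {V : Type*} [AddCommGroup V] [Module ℝ V]
variable {Q : QuadraticForm ℝ V} {K : Type*} [AddCommGroup K] [Module ℂ K]

/-- σ-compatibility of a representation with a hermitian form:
`(ρ(a)ψ, φ) = (ψ, ρ(a^{×_σ})φ)` where `a^{×_σ} = σ(aᵀ)`. -/
def Compat (σ : RealStructure Q) (ρ : CCl Q →ₐ[ℂ] Module.End ℂ K)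
    (h : SesqForm K) : Prop :=
  ∀ (a : CCl Q) (ψ φ : K),
    h.form (ρ a ψ) φ = h.form ψ (ρ (σ.toFun (CliffordAlgebra.reverse a)) φ)

/-- Irreducibility of a representation: `K` is a simple module. -/
def IsIrreducibleRep (ρ : CCl Q →ₐ[ℂ] Module.End ℂ K) : Prop :=
  (∃ x : K, x ≠ 0) ∧
    ∀ p : Submodule ℂ K, (∀ a : CCl Q, ∀ x ∈ p, ρ a x ∈ p) → p = ⊥ ∨ p = ⊤

end Rep

section Signature

variable {V : Type*} [AddCommGroup V] [Module ℝ V]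

/-- `Q` has signature `(p, q)`: there is a pseudo-orthonormal basis with `p` vectors of
square `+1` and `q` vectors of square `−1`. -/
def HasSignature (Q : QuadraticForm ℝ V) (p q : ℕ) : Prop :=
  ∃ e : Fin (p + q) → V,
    LinearIndependent ℝ e ∧ Submodule.span ℝ (Set.range e) = ⊤
    ∧ (∀ i j, i ≠ j → QuadraticMap.polar Q (e i) (e j) = 0)
    ∧ (∀ i : Fin (p + q), (i : ℕ) < p → Q (e i) = 1)
    ∧ (∀ i : Fin (p + q), p ≤ (i : ℕ) → Q (e i) = -1)

/-- `v` and `w` can be joined by a segment staying in `{Q > 0}` (same component of the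
open light cone, anti-Lorentzian convention). -/
def SameConePos (Q : QuadraticForm ℝ V) (v w : V) : Prop :=
  ∀ t : ℝ, 0 ≤ t → t ≤ 1 → 0 < Q ((1 - t) • v + t • w)

/-- `Cp`, `Cn` are the two connected components of the open cone `{Q > 0}`. -/
def IsConeComponentsPos (Q : QuadraticForm ℝ V) (Cp Cn : Set V) : Prop :=
  Cp ∪ Cn = {v | 0 < Q v} ∧ Cp ∩ Cn = ∅ ∧ Cp.Nonempty ∧ Cn.Nonempty
  ∧ (∀ v ∈ Cp, ∀ w ∈ Cp, SameConePos Q v w)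
  ∧ (∀ v ∈ Cn, ∀ w ∈ Cn, SameConePos Q v w)
  ∧ (∀ v ∈ Cp, ∀ w ∈ Cn, ¬ SameConePos Q v w)

/-- `v` and `w` can be joined by a segment staying in `{Q < 0}` (same component of the
open light cone, Lorentzian convention). -/
def SameConeNeg (Q : QuadraticForm ℝ V) (v w : V) : Prop :=
  ∀ t : ℝ, 0 ≤ t → t ≤ 1 → Q ((1 - t) • v + t • w) < 0

/-- `Cp`, `Cn` are the two connected components of the open cone `{Q < 0}`. -/
def IsConeComponentsNeg (Q : QuadraticForm ℝ V) (Cp Cn : Set V) : Prop :=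
  Cp ∪ Cn = {v | Q v < 0} ∧ Cp ∩ Cn = ∅ ∧ Cp.Nonempty ∧ Cn.Nonempty
  ∧ (∀ v ∈ Cp, ∀ w ∈ Cp, SameConeNeg Q v w)
  ∧ (∀ v ∈ Cn, ∀ w ∈ Cn, SameConeNeg Q v w)
  ∧ (∀ v ∈ Cp, ∀ w ∈ Cn, ¬ SameConeNeg Q v w)

end Signature

namespace SesqForm

variable {K : Type*} [AddCommGroup K] [Module ℂ K]

theorem zero_left (h : SesqForm K) (y : K) : h.form 0 y = 0 := by
  simpa using h.smul_left 0 0 y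

theorem zero_right (h : SesqForm K) (x : K) : h.form x 0 = 0 := by
  simpa using h.smul_right 0 x 0

theorem neg_left (h : SesqForm K) (x y : K) : h.form (-x) y = -h.form x y := by
  simpa using h.smul_left (-1) x y

theorem neg_right (h : SesqForm K) (x y : K) : h.form x (-y) = -h.form x y := by
  simpa using h.smul_right (-1) x y

theorem form_self_eq_re (h : SesqForm K) (x : K) : h.form x x = ((h.form x x).re : ℂ) :=
  (Complex.conj_eq_iff_re.1 (h.herm x x).symm).symm

/-- The sum of a form and its pullback along a linear map. -/
def addPullback (B : SesqForm K) (T : Module.End ℂ K) : SesqForm K where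
  form x y := B.form x y + B.form (T x) (T y)
  add_left x y z := by simp only [map_add, B.add_left]; ring
  add_right x y z := by simp only [map_add, B.add_right]; ring
  smul_left a x y := by simp only [map_smul, B.smul_left]; ring
  smul_right a x y := by simp only [map_smul, B.smul_right]; ring
  herm x y := by rw [map_add, ← B.herm, ← B.herm]

theorem exists_posDef [FiniteDimensional ℂ K] :
    ∃ B : SesqForm K, ∀ x, x ≠ 0 → 0 < (B.form x x).re := by
  let b := Module.finBasis ℂ K
  refine ⟨⟨fun x y => ∑ i, starRingEnd ℂ (b.repr x i) * b.repr y i, ?_, ?_, ?_, ?_, ?_⟩, ?_⟩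
  · intro x y z; simp [add_mul, Finset.sum_add_distrib]
  · intro x y z; simp [mul_add, Finset.sum_add_distrib]
  · intro a x y; simp [Finset.mul_sum, mul_assoc]
  · intro a x y; simp [Finset.mul_sum, mul_left_comm]
  · intro x y; simp [mul_comm]
  · intro x hx
    have hterm : ∀ i, (starRingEnd ℂ (b.repr x i) * b.repr x i).re
        = Complex.normSq (b.repr x i) := fun i => by
      rw [← Complex.normSq_eq_conj_mul_self, Complex.ofReal_re]
    simp only [Complex.re_sum, hterm]
    refine Finset.sum_pos' (fun i _ => Complex.normSq_nonneg _) ?_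
    by_contra! hcon
    refine hx (b.repr.map_eq_zero_iff.1 (Finsupp.ext fun i => ?_))
    exact Complex.normSq_eq_zero.1 (le_antisymm (hcon i (Finset.mem_univ i))
      (Complex.normSq_nonneg _))

/-- A finite family of pairwise anticommuting operators with squares `±1` preserves some
positive definite form. -/
theorem exists_posDef_invariant [FiniteDimensional ℂ K] {ι : Type*} [DecidableEq ι]
    (T : ι → Module.End ℂ K) (hsq : ∀ i, (∀ x, T i (T i x) = x) ∨ ∀ x, T i (T i x) = -x)
    (hanti : ∀ i j, i ≠ j → ∀ x, T i (T j x) = -T j (T i x)) (s : Finset ι) :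
    ∃ B : SesqForm K, (∀ x, x ≠ 0 → 0 < (B.form x x).re)
      ∧ ∀ i ∈ s, ∀ x y, B.form (T i x) (T i y) = B.form x y := by
  induction s using Finset.induction_on with
  | empty =>
    obtain ⟨B, hB⟩ := exists_posDef (K := K)
    exact ⟨B, hB, by simp⟩
  | insert a s _ ih =>
    obtain ⟨B, hB, hinv⟩ := ih
    refine ⟨B.addPullback (T a), fun x hx => ?_, fun i hi x y => ?_⟩
    · have hTx : T a x ≠ 0 := by
        intro h0
        rcases hsq a with h1 | h1 <;> exact hx (by simpa [h0] using (h1 x).symm)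
      exact add_pos (hB x hx) (hB _ hTx)
    · change B.form (T i x) (T i y) + B.form (T a (T i x)) (T a (T i y))
        = B.form x y + B.form (T a x) (T a y)
      by_cases hia : i = a
      · subst hia
        rcases hsq i with h1 | h1
        · rw [h1, h1, add_comm]
        · rw [h1, h1, B.neg_left, B.neg_right, _root_.neg_neg, add_comm]
      · have his : i ∈ s := (Finset.mem_insert.1 hi).resolve_left hia
        rw [hanti a i (Ne.symm hia), hanti a i (Ne.symm hia), B.neg_left, B.neg_right,
          _root_.neg_neg, hinv i his, hinv i his]

/-- Riesz representation of one form by a positive definite one. -/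
theorem exists_representing_end [FiniteDimensional ℂ K] (B G : SesqForm K)
    (hB : ∀ x, x ≠ 0 → 0 < (B.form x x).re) :
    ∃ A : Module.End ℂ K, ∀ x y, B.form (A x) y = G.form x y := by
  let L : SesqForm K → (K →ₗ[ℝ] Module.Dual ℂ K) := fun F =>
    { toFun := fun x =>
        { toFun := fun y => F.form x y
          map_add' := F.add_right x
          map_smul' := fun a y => F.smul_right a x y }
      map_add' := fun x y => LinearMap.ext fun z => F.add_left x y z
      map_smul' := fun r x => LinearMap.ext fun z => by
        simpa using F.smul_left (r : ℂ) x z }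
  have hL : ∀ F x y, L F x y = F.form x y := fun _ _ _ => rfl
  have hinj : Function.Injective (L B) := by
    refine (injective_iff_map_eq_zero _).2 fun x hx => ?_
    by_contra hne
    have := hB x hne
    rw [← hL, hx] at this
    simp at this
  have : FiniteDimensional ℝ K := FiniteDimensional.complexToReal K
  have : FiniteDimensional ℝ (Module.Dual ℂ K) := FiniteDimensional.complexToReal _
  have hsurj : Function.Surjective (L B) := by
    refine (LinearMap.injective_iff_surjective_of_finrank_eq_finrank ?_).1 hinj
    rw [finrank_real_of_complex, finrank_real_of_complex, Subspace.dual_finrank_eq]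
  choose A hA using fun x => hsurj (L G x)
  have hA' : ∀ x y, B.form (A x) y = G.form x y := fun x y => by rw [← hL, hA, hL]
  refine ⟨⟨⟨A, fun x y => hinj ?_⟩, fun a x => hinj ?_⟩, hA'⟩
  · refine LinearMap.ext fun z => ?_
    rw [hL, hL, hA', G.add_left, B.add_left, hA', hA']
  · refine LinearMap.ext fun z => ?_
    simp only [hL, hA', G.smul_left, B.smul_left, RingHom.id_apply]

end SesqForm

/-- An operator-valued map on `V` satisfying the Clifford relation by operators which are
symmetric for `h`. -/
structure SymmCliffordAction (Q : QuadraticForm ℝ V) {K : Type*} [AddCommGroup K] [Module ℂ K]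
    (h : SesqForm K) where
  R : V → Module.End ℂ K
  add : ∀ u v x, R (u + v) x = R u x + R v x
  smul : ∀ (r : ℝ) v x, R (r • v) x = (r : ℂ) • R v x
  sq : ∀ v x, R v (R v x) = (Q v : ℂ) • x
  symm : ∀ v x y, h.form (R v x) y = h.form x (R v y)

namespace SymmCliffordAction

variable {Q : QuadraticForm ℝ V} {K : Type*} [AddCommGroup K] [Module ℂ K] {h : SesqForm K}
  (S : SymmCliffordAction Q h)

theorem anticomm (u v : V) (x : K) :
    S.R u (S.R v x) = ((QuadraticMap.polar Q u v : ℝ) : ℂ) • x - S.R v (S.R u x) := by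
  have h1 := S.sq (u + v) x
  simp only [S.add, map_add, S.sq] at h1
  simp only [QuadraticMap.polar, Complex.ofReal_sub, sub_smul]
  rw [← h1]
  abel

theorem anticomm_of_polar_eq_zero {u v : V} (huv : QuadraticMap.polar Q u v = 0) (x : K) :
    S.R u (S.R v x) = -S.R v (S.R u x) := by
  rw [S.anticomm, huv]; simp

/-- The quadratic expression `(ψ, v ψ)`, a real number. -/
def q (v : V) (x : K) : ℝ := (h.form x (S.R v x)).re

theorem form_eq_q (v : V) (x : K) : h.form x (S.R v x) = (S.q v x : ℂ) := by
  refine (Complex.conj_eq_iff_re.1 ?_).symm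
  rw [← h.herm, S.symm]

theorem q_add (u v : V) (x : K) : S.q (u + v) x = S.q u x + S.q v x := by
  simp [q, S.add, h.add_right]

theorem q_smul (r : ℝ) (v : V) (x : K) : S.q (r • v) x = r * S.q v x := by
  rw [q, S.smul, h.smul_right, Complex.re_ofReal_mul, q]

theorem q_apply (u v : V) (x : K) :
    S.q v (S.R u x) = (h.form x (S.R u (S.R v (S.R u x)))).re := by
  rw [q, S.symm]

/-- The form `l (ψ, v φ)` is positive definite. -/
def Pos (l : ℝ) (v : V) : Prop := ∀ x : K, x ≠ 0 → 0 < l * S.q v x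

theorem q_self_apply (v : V) (x : K) : S.q v (S.R v x) = Q v * S.q v x := by
  rw [q_apply, S.sq, h.smul_right, S.form_eq_q, ← Complex.ofReal_mul, Complex.ofReal_re]

variable {S}

theorem Pos.neg_neg {l : ℝ} {v : V} (hv : S.Pos l v) : S.Pos (-l) (-v) := fun x hx => by
  have := hv x hx
  rw [← neg_one_smul ℝ v, S.q_smul]; linarith

theorem Pos.not_neg [Nontrivial K] {l : ℝ} {v : V} (hv : S.Pos l v) : ¬ S.Pos (-l) v := by
  intro hv'
  obtain ⟨x, hx⟩ := exists_ne (0 : K)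
  have h1 := hv x hx
  have h2 := hv' x hx
  linarith

theorem Pos.quadratic_pos [Nontrivial K] {l : ℝ} {v : V} (hv : S.Pos l v) : 0 < Q v := by
  obtain ⟨x, hx⟩ := exists_ne (0 : K)
  have h1 := hv x hx
  have hne : S.R v x ≠ 0 := by
    intro h0
    simp [q, h0, h.zero_right] at h1
  have h2 := hv _ hne
  rw [S.q_self_apply] at h2
  have h3 : 0 < Q v * (l * S.q v x) := by linarith
  exact pos_of_mul_pos_left h3 h1.le

theorem Pos.quadratic_neg_of_polar_eq_zero [Nontrivial K] (hQ : QFNondeg Q) {l : ℝ} {v w : V}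
    (hv : S.Pos l v) (hw : w ≠ 0) (hvw : QuadraticMap.polar Q v w = 0) : Q w < 0 := by
  have hex : ∃ x, S.R w x ≠ 0 := by
    by_contra! hcon
    refine hw (hQ w fun u => ?_)
    obtain ⟨x, hx⟩ := exists_ne (0 : K)
    have := S.anticomm w u x
    simp only [hcon, map_zero, sub_zero] at this
    simpa [hx] using this.symm
  obtain ⟨x, hx⟩ := hex
  have hx0 : x ≠ 0 := by rintro rfl; simp at hx
  have h1 := hv x hx0
  have h2 := hv _ hx
  rw [q_apply, S.anticomm_of_polar_eq_zero hvw, map_neg, S.sq, h.neg_right, h.smul_right,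
    S.form_eq_q, ← Complex.ofReal_mul, ← Complex.ofReal_neg, Complex.ofReal_re] at h2
  have h3 : 0 < (-Q w) * (l * S.q v x) := by linarith
  linarith [pos_of_mul_pos_left h3 h1.le]

/-- If `v` is conjugate to the unit vector `e` through `u = s e + v`, definiteness passes
from `e` to `v`. -/
theorem Pos.of_polar_nonneg {l : ℝ} {e v : V} (he : S.Pos l e)
    (hQe : Q e = 1) (hv : 0 < Q v) (hp : 0 ≤ QuadraticMap.polar Q e v) : S.Pos l v := by
  set s := √(Q v) with hs
  have hs0 : 0 < s := Real.sqrt_pos.2 hv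
  have hss : s * s = Q v := Real.mul_self_sqrt hv.le
  set p := QuadraticMap.polar Q e v with hpdef
  set u := s • e + v with hu
  have hQu : Q u = s * (2 * s + p) := by
    have h1 : QuadraticMap.polar Q (s • e) v = s * p := by
      rw [QuadraticMap.polar_smul_left, smul_eq_mul]
    have h2 : Q (s • e) = s * s := by rw [QuadraticMap.map_smul, hQe, smul_eq_mul, mul_one]
    rw [QuadraticMap.polar] at h1
    linarith
  have hpol : QuadraticMap.polar Q u e = 2 * s + p := by
    rw [hu, QuadraticMap.polar_add_left, QuadraticMap.polar_smul_left, QuadraticMap.polar_self,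
      hQe, QuadraticMap.polar_comm Q v e]
    simp; ring
  have hsp : 0 < 2 * s + p := by positivity
  have hQu0 : 0 < Q u := hQu ▸ mul_pos hs0 hsp
  intro x hx
  have hux : S.R u x ≠ 0 := by
    intro h0
    have := S.sq u x
    rw [h0, map_zero] at this
    rcases smul_eq_zero.1 this.symm with h1 | h1
    · exact hQu0.ne' (by exact_mod_cast h1)
    · exact hx h1
  have hconj : S.R u (S.R e (S.R u x)) = ((2 * s + p : ℝ) : ℂ) • S.R v x := by
    rw [S.anticomm, hpol, S.sq, map_smul, hQu, hu, S.add, S.smul]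
    push_cast
    module
  have h1 := he _ hux
  rw [q_apply, hconj, h.smul_right, S.form_eq_q, ← Complex.ofReal_mul, Complex.ofReal_re] at h1
  have h2 : 0 < (2 * s + p) * (l * S.q v x) := by linarith
  exact pos_of_mul_pos_right h2 hsp.le

theorem Pos.pos_or_neg {l : ℝ} {e v : V} (he : S.Pos l e) (hQe : Q e = 1) (hv : 0 < Q v) :
    S.Pos l v ∨ S.Pos (-l) v := by
  rcases le_total 0 (QuadraticMap.polar Q e v) with hp | hp
  · exact Or.inl (he.of_polar_nonneg hQe hv hp)
  · have := (he.of_polar_nonneg (v := -v) hQe (by simpa using hv) (by simpa using hp)).neg_neg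
    exact Or.inr (by simpa using this)

theorem Pos.exists_unit [Nontrivial K] {l : ℝ} {v : V} (hv : S.Pos l v) :
    ∃ e, S.Pos l e ∧ Q e = 1 := by
  have hQ := hv.quadratic_pos
  have hs0 : 0 < √(Q v) := Real.sqrt_pos.2 hQ
  have hss : √(Q v) * √(Q v) = Q v := Real.mul_self_sqrt hQ.le
  refine ⟨(√(Q v))⁻¹ • v, fun x hx => ?_, ?_⟩
  · rw [S.q_smul, mul_left_comm]
    exact mul_pos (inv_pos.2 hs0) (hv x hx)
  · rw [QuadraticMap.map_smul, smul_eq_mul]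
    field_simp
    nlinarith

theorem Pos.sameConePos [Nontrivial K] {l : ℝ} {v w : V} (hv : S.Pos l v) (hw : S.Pos l w) :
    SameConePos Q v w := by
  intro t ht0 ht1
  refine Pos.quadratic_pos (S := S) (l := l) fun x hx => ?_
  have h1 := hv x hx
  have h2 := hw x hx
  rw [S.q_add, S.q_smul, S.q_smul]
  rcases ht0.eq_or_lt with rfl | ht
  · linarith
  · have := mul_pos ht h2
    have := mul_nonneg (sub_nonneg.2 ht1) h1.le
    linarith

theorem Pos.of_sameConePos [Nontrivial K] {l : ℝ}
    (hdef : ∀ v, 0 < Q v → S.Pos l v ∨ S.Pos (-l) v)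
    {v w : V} (hv : S.Pos l v) (hvw : SameConePos Q v w) : S.Pos l w := by
  have hQw : 0 < Q w := by simpa using hvw 1 zero_le_one le_rfl
  refine (hdef w hQw).resolve_right fun hw => ?_
  obtain ⟨x, hx⟩ := exists_ne (0 : K)
  have h1 := hv x hx
  have h2 := hw x hx
  set a := l * S.q v x
  have hab : 0 < a + -l * S.q w x := by linarith
  have hmid : l * S.q ((1 - a / (a + -l * S.q w x)) • v + (a / (a + -l * S.q w x)) • w) x = 0 := by
    rw [S.q_add, S.q_smul, S.q_smul]
    have ha : a = l * S.q v x := rfl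
    have hD := div_mul_cancel₀ a hab.ne'
    linear_combination (-1 + a / (a + -l * S.q w x)) * ha - hD
  have := hdef _ (hvw (a / (a + -l * S.q w x)) (by positivity)
    ((div_le_one hab).2 (by linarith)))
  rcases this with h3 | h3
  · have := h3 x hx; linarith
  · have := h3 x hx; linarith

/-- If the Clifford action is definite along some vector, the signature is anti-Lorentzian. -/
theorem Pos.hasSignature [Nontrivial K] [FiniteDimensional ℝ V] (hQ : QFNondeg Q) {l : ℝ} {v : V}
    (hv : S.Pos l v) : HasSignature Q 1 (Module.finrank ℝ V - 1) := by
  obtain ⟨e, he, hQe⟩ := hv.exists_unit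
  have hsep : (QuadraticMap.associated (R := ℝ) Q).SeparatingLeft := by
    intro x hx
    refine hQ x fun y => ?_
    have := hx y
    rw [QuadraticMap.associated_apply] at this
    simpa [QuadraticMap.polar] using this
  obtain ⟨w, hw, ⟨f⟩⟩ := Q.equivalent_one_neg_one_weighted_sum_squared hsep
  let b : Module.Basis (Fin (Module.finrank ℝ V)) ℝ V :=
    (Pi.basisFun ℝ _).map f.toLinearEquiv.symm
  have hfb : ∀ i, f (b i) = Pi.single i 1 := fun i => by
    simp only [b, Module.Basis.map_apply, Pi.basisFun_apply]
    exact f.toLinearEquiv.apply_symm_apply _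
  have hQb : ∀ i, Q (b i) = w i := fun i => by
    rw [← f.map_app, hfb, QuadraticMap.weightedSumSquares_apply]
    simp [Pi.single_apply]
  have hpolb : ∀ i j, i ≠ j → QuadraticMap.polar Q (b i) (b j) = 0 := fun i j hij => by
    have hadd : Q (b i + b j) = w i + w j := by
      rw [← f.map_app, map_add, hfb, hfb, QuadraticMap.weightedSumSquares_apply,
        ← Finset.add_sum_erase _ _ (Finset.mem_univ i),
        ← Finset.add_sum_erase _ _ (Finset.mem_erase.2 ⟨hij.symm, Finset.mem_univ j⟩)]
      rw [Finset.sum_eq_zero]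
      · simp [hij, hij.symm]
      · intro k hk
        simp only [Finset.mem_erase] at hk
        simp [hk.1, hk.2.1]
    rw [QuadraticMap.polar, hadd, hQb, hQb]; ring
  have hex : ∃ i, w i = 1 := by
    by_contra! hcon
    have hneg : ∀ i, w i = -1 := fun i => (hw i).resolve_right (hcon i)
    have h1 := f.map_app e
    rw [hQe, QuadraticMap.weightedSumSquares_apply] at h1
    have h2 : ∑ i, w i • (f e i * f e i) ≤ 0 := Finset.sum_nonpos fun i _ => by
      rw [hneg, smul_eq_mul]; nlinarith [mul_self_nonneg (f e i)]
    linarith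
  obtain ⟨i₀, hi₀⟩ := hex
  have huniq : ∀ j, j ≠ i₀ → w j = -1 := by
    intro j hj
    have hneg : Q (b j) < 0 := by
      rcases he.pos_or_neg hQe (v := b i₀) (by rw [hQb, hi₀]; norm_num) with hp | hp
      · exact hp.quadratic_neg_of_polar_eq_zero hQ (b.ne_zero j) (hpolb _ _ hj.symm)
      · exact hp.quadratic_neg_of_polar_eq_zero hQ (b.ne_zero j) (hpolb _ _ hj.symm)
    refine (hw j).resolve_right fun h1 => ?_
    rw [hQb, h1] at hneg
    linarith
  have hn : 1 + (Module.finrank ℝ V - 1) = Module.finrank ℝ V := by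
    have := i₀.pos
    omega
  let σ : Fin (1 + (Module.finrank ℝ V - 1)) ≃ Fin (Module.finrank ℝ V) :=
    (finCongr hn).trans (Equiv.swap ⟨0, i₀.pos⟩ i₀)
  let b' := b.reindex σ.symm
  have hb' : ∀ i, b' i = b (σ i) := fun i => by simp [b']
  have hσ : ∀ i, σ i = i₀ ↔ (i : ℕ) = 0 := fun i => by
    have h0 : σ ⟨0, by omega⟩ = i₀ := Equiv.swap_apply_left ⟨0, i₀.pos⟩ i₀
    rw [← h0, σ.apply_eq_iff_eq, Fin.ext_iff]
  refine ⟨b', b'.linearIndependent, b'.span_eq, fun i j hij => ?_, fun i hi => ?_, fun i hi => ?_⟩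
  · rw [hb', hb']
    exact hpolb _ _ (σ.injective.ne hij)
  · rw [hb', hQb, (hσ i).2 (by omega), hi₀]
  · rw [hb', hQb, huniq _ (fun h0 => by have := (hσ i).1 h0; omega)]

/-- In anti-Lorentzian signature, an irreducible Clifford action is definite along a timelike
unit vector. -/
theorem exists_pos_of_hasSignature [Nontrivial K] [FiniteDimensional ℂ K] {m : ℕ}
    (hirr : ∀ p : Submodule ℂ K, (∀ v, ∀ x ∈ p, S.R v x ∈ p) → p = ⊥ ∨ p = ⊤)
    (hnd : h.Nondeg) (hsig : HasSignature Q 1 m) :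
    ∃ e, Q e = 1 ∧ ∃ l : ℝ, (l = 1 ∨ l = -1) ∧ S.Pos l e := by
  obtain ⟨e, -, hspan, horth, hone, hneg⟩ := hsig
  let i₀ : Fin (1 + m) := ⟨0, by omega⟩
  have hQe₀ : Q (e i₀) = 1 := hone i₀ (by simp [i₀])
  let G : SesqForm K :=
    { form := fun x y => h.form x (S.R (e i₀) y)
      add_left := fun x y z => h.add_left _ _ _
      add_right := fun x y z => by rw [map_add, h.add_right]
      smul_left := fun a x y => h.smul_left _ _ _
      smul_right := fun a x y => by rw [map_smul, h.smul_right]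
      herm := fun x y => by rw [← h.herm, S.symm] }
  have hGapp : ∀ x y, G.form x y = h.form x (S.R (e i₀) y) := fun _ _ => rfl
  have hQcase : ∀ i, Q (e i) = 1 ∨ Q (e i) = -1 := fun i =>
    (lt_or_ge (i : ℕ) 1).imp (hone i) (hneg i)
  obtain ⟨B, hB, hinv⟩ := SesqForm.exists_posDef_invariant (fun i => S.R (e i))
    (fun i => (hQcase i).imp (fun hi x => by simp [S.sq, hi]) (fun hi x => by simp [S.sq, hi]))
    (fun i j hij x => S.anticomm_of_polar_eq_zero (horth i j hij) x) Finset.univ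
  have hBadj : ∀ i x y, B.form x (S.R (e i) y) = (Q (e i) : ℂ) * B.form (S.R (e i) x) y := by
    intro i x y
    rw [← hinv i (Finset.mem_univ i) x, S.sq, B.smul_right]
  have hGadj : ∀ i x y, G.form x (S.R (e i) y) = (Q (e i) : ℂ) * G.form (S.R (e i) x) y := by
    intro i x y
    rw [hGapp, hGapp, S.symm]
    by_cases hi : i = i₀
    · rw [hi, hQe₀]; simp
    · rw [S.anticomm_of_polar_eq_zero (horth i i₀ hi), hneg i (by
        by_contra hlt
        exact hi (Fin.ext (by simp only [i₀]; omega))), h.neg_right]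
      simp
  obtain ⟨A, hA⟩ := SesqForm.exists_representing_end B G hB
  obtain ⟨μ, hμ⟩ := Module.End.exists_eigenvalue A
  obtain ⟨x₀, hx₀⟩ := hμ.exists_hasEigenvector
  let p : Submodule ℂ K :=
    { carrier := {x | ∀ y, G.form x y = starRingEnd ℂ μ * B.form x y}
      zero_mem' := fun y => by rw [G.zero_left, B.zero_left, mul_zero]
      add_mem' := fun hx hx' y => by rw [G.add_left, B.add_left, hx y, hx' y, mul_add]
      smul_mem' := fun a x hx y => by rw [G.smul_left, B.smul_left, hx y, mul_left_comm] }
  have hp : ∀ v, ∀ x ∈ p, S.R v x ∈ p := by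
    intro v x hx
    have hv : v ∈ Submodule.span ℝ (Set.range e) := hspan ▸ Submodule.mem_top
    induction hv using Submodule.span_induction with
    | mem v hv =>
      obtain ⟨i, rfl⟩ := hv
      intro y
      have hne : (Q (e i) : ℂ) ≠ 0 := by rcases hQcase i with hi | hi <;> simp [hi]
      refine mul_left_cancel₀ hne ?_
      rw [← hGadj, hx, hBadj]; ring
    | zero =>
      have : S.R 0 x = 0 := by simpa using S.smul 0 0 x
      rw [this]; exact p.zero_mem
    | add u v _ _ hu hv => rw [S.add]; exact p.add_mem hu hv
    | smul r v _ hv => rw [S.smul]; exact p.smul_mem _ hv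
  have hx₀p : x₀ ∈ p := fun y => by rw [← hA, hx₀.apply_eq_smul, B.smul_left]
  have htop : p = ⊤ := (hirr p hp).resolve_left fun hbot => hx₀.2 (by
    rwa [hbot, Submodule.mem_bot] at hx₀p)
  have hGB : ∀ x y, G.form x y = starRingEnd ℂ μ * B.form x y := fun x =>
    show x ∈ p from htop ▸ Submodule.mem_top
  have hq : ∀ x, S.q (e i₀) x = μ.re * (B.form x x).re := fun x => by
    have h1 : S.q (e i₀) x = (G.form x x).re := rfl
    rw [h1, hGB, B.form_self_eq_re, Complex.re_mul_ofReal, Complex.conj_re, Complex.ofReal_re]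
  have hreal : μ.im = 0 := by
    have h1 := hGB x₀ x₀
    rw [G.form_self_eq_re, B.form_self_eq_re] at h1
    have h2 := congrArg Complex.im h1
    rw [Complex.im_mul_ofReal, Complex.ofReal_im, Complex.conj_im] at h2
    rcases mul_eq_zero.1 h2.symm with h3 | h3
    · linarith
    · exact absurd h3 (hB x₀ hx₀.2).ne'
  have hμ0 : μ.re ≠ 0 := by
    intro h0
    have hμz : μ = 0 := Complex.ext h0 hreal
    refine hx₀.2 (hnd x₀ fun y => ?_)
    have h1 := hGB x₀ (S.R (e i₀) y)
    rwa [hGapp, S.sq, hQe₀, hμz, Complex.ofReal_one, one_smul, map_zero, zero_mul] at h1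
  refine ⟨e i₀, hQe₀, ?_⟩
  rcases hμ0.lt_or_gt with hlt | hlt
  · refine ⟨-1, Or.inr rfl, fun x hx => ?_⟩
    rw [hq]
    have := mul_pos (neg_pos.2 hlt) (hB x hx)
    linarith
  · refine ⟨1, Or.inl rfl, fun x hx => ?_⟩
    rw [hq, one_mul]
    exact mul_pos hlt (hB x hx)

end SymmCliffordAction

/-- The Clifford action underlying a `c`-compatible representation. -/
def Compat.symmCliffordAction {Q : QuadraticForm ℝ V} {c : RealStructure Q}
    (hc : IsCanonicalC c) {K : Type*} [AddCommGroup K] [Module ℂ K]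
    {ρ : CCl Q →ₐ[ℂ] Module.End ℂ K} {h : SesqForm K} (hcompat : Compat c ρ h) :
    SymmCliffordAction Q h where
  R v := ρ (ιr Q v)
  add u v x := by simp [ιr, TensorProduct.tmul_add]
  smul r v x := by
    have : (1 : ℂ) ⊗ₜ[ℝ] (r • v) = (r : ℂ) • ((1 : ℂ) ⊗ₜ[ℝ] v) := by
      rw [← TensorProduct.smul_tmul, TensorProduct.smul_tmul']; simp
    rw [ιr, this, map_smul, map_smul, LinearMap.smul_apply, ιr]
  sq v x := by
    rw [← Module.End.mul_apply, ← map_mul, ιr, CliffordAlgebra.ι_sq_scalar,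
      QuadraticForm.baseChange_tmul]
    simp [Algebra.smul_def]
  symm v x y := by
    have := hcompat (ιr Q v) x y
    rwa [show CliffordAlgebra.reverse (ιr Q v) = ιr Q v from CliffordAlgebra.reverse_ι _, hc]
      at this

theorem IsIrreducibleRep.eq_bot_or_top {Q : QuadraticForm ℝ V} {K : Type*} [AddCommGroup K]
    [Module ℂ K] {ρ : CCl Q →ₐ[ℂ] Module.End ℂ K} (hirr : IsIrreducibleRep ρ)
    (p : Submodule ℂ K) (hp : ∀ v, ∀ x ∈ p, ρ (ιr Q v) x ∈ p) : p = ⊥ ∨ p = ⊤ := by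
  refine hirr.2 p fun a => ?_
  induction a using CliffordAlgebra.induction with
  | algebraMap r =>
    intro x hx
    simpa using p.smul_mem r hx
  | ι m =>
    induction m using TensorProduct.induction_on with
    | zero => intro x _; simp
    | tmul z v =>
      intro x hx
      have : z ⊗ₜ[ℝ] v = z • ((1 : ℂ) ⊗ₜ[ℝ] v) := by
        rw [TensorProduct.smul_tmul']; simp
      rw [this, map_smul, map_smul]
      exact p.smul_mem z (hp v x hx)
    | add m₁ m₂ h₁ h₂ =>
      intro x hx
      rw [map_add, map_add]
      exact p.add_mem (h₁ x hx) (h₂ x hx)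
  | mul a b ha hb =>
    intro x hx
    rw [map_mul]
    exact ha _ (hb x hx)
  | add a b ha hb =>
    intro x hx
    rw [map_add]
    exact p.add_mem (ha x hx) (hb x hx)

/-- `Q` is anti-Lorentzian iff there is `v ∈ V` (invertible in `ℂl(V)`)
with `(·,·)_v = (·, ρ(v)⁻¹·)` definite; moreover, in the anti-Lorentzian case, `(·,·)_v` is
definite exactly for `v` in the open light cone `C`, and a single sign `λ = ±1` makes
`λ(·,·)_v` positive definite exactly on `C₊` and negative definite exactly on `C₋`. -/
theorem statement16 [FiniteDimensional ℝ V] (Q : QuadraticForm ℝ V)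
    (hdim : Even (Module.finrank ℝ V)) (hQ : QFNondeg Q)
    (c : RealStructure Q) (hc : IsCanonicalC c)
    {K : Type*} [AddCommGroup K] [Module ℂ K] [FiniteDimensional ℂ K]
    (ρ : CCl Q →ₐ[ℂ] Module.End ℂ K) (hirr : IsIrreducibleRep ρ)
    (h : SesqForm K) (hnd : h.Nondeg) (hcompat : Compat c ρ h) :
    -- the characterization of the anti-Lorentzian signature
    (HasSignature Q 1 (Module.finrank ℝ V - 1)
      ↔ ∃ v : V, Q v ≠ 0
          ∧ FDefinite (fun ψ φ : K => h.form ψ (ρ (((Q v : ℂ))⁻¹ • ιr Q v) φ)))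
    -- in the anti-Lorentzian case, the light cone and its components
    ∧ (HasSignature Q 1 (Module.finrank ℝ V - 1) →
        (∀ v : V, Q v ≠ 0 →
          (FDefinite (fun ψ φ : K => h.form ψ (ρ (((Q v : ℂ))⁻¹ • ιr Q v) φ))
            ↔ 0 < Q v))
        ∧ (∀ Cp Cn : Set V, IsConeComponentsPos Q Cp Cn →
            ∃ l : ℝ, (l = 1 ∨ l = -1)
              ∧ ∀ v : V, 0 < Q v →
                ((FPosDef (fun ψ φ : K =>
                    (l : ℂ) * h.form ψ (ρ (((Q v : ℂ))⁻¹ • ιr Q v) φ)) ↔ v ∈ Cp)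
                ∧ (FNegDef (fun ψ φ : K =>
                    (l : ℂ) * h.form ψ (ρ (((Q v : ℂ))⁻¹ • ιr Q v) φ)) ↔ v ∈ Cn)))) := by
  have : Nontrivial K := let ⟨x, hx⟩ := hirr.1; ⟨x, 0, hx⟩
  let S := hcompat.symmCliffordAction hc
  have hform : ∀ (v : V) (x : K), h.form x (ρ (((Q v : ℂ))⁻¹ • ιr Q v) x)
      = (((Q v)⁻¹ * S.q v x : ℝ) : ℂ) := fun v x => by
    rw [map_smul, LinearMap.smul_apply, h.smul_right,
      show h.form x (ρ (ιr Q v) x) = (S.q v x : ℂ) from S.form_eq_q v x]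
    push_cast; ring
  have hposdef : ∀ (l : ℝ) (v : V), FPosDef (fun ψ φ : K =>
      (l : ℂ) * h.form ψ (ρ (((Q v : ℂ))⁻¹ • ιr Q v) φ)) ↔ S.Pos (l * (Q v)⁻¹) v := by
    intro l v
    refine forall_congr' fun x => imp_congr_right fun _ => ?_
    simp only [hform, ← Complex.ofReal_mul, Complex.ofReal_inj]
    rw [exists_eq_right', mul_assoc]
  have hnegdef : ∀ (l : ℝ) (v : V), FNegDef (fun ψ φ : K =>
      (l : ℂ) * h.form ψ (ρ (((Q v : ℂ))⁻¹ • ιr Q v) φ)) ↔ S.Pos (-l * (Q v)⁻¹) v := by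
    intro l v
    refine forall_congr' fun x => imp_congr_right fun _ => ?_
    simp only [hform, ← Complex.ofReal_mul, Complex.ofReal_inj]
    rw [exists_eq_right', ← neg_pos, neg_mul, neg_mul, mul_assoc]
  have hscale : ∀ (l : ℝ) (v : V), 0 < Q v → (S.Pos (l * (Q v)⁻¹) v ↔ S.Pos l v) := by
    intro l v hv
    refine forall_congr' fun x => imp_congr_right fun _ => ?_
    rw [mul_right_comm, mul_pos_iff_of_pos_right (inv_pos.2 hv)]
  have hdefinite : ∀ v : V, FDefinite (fun ψ φ : K =>
      h.form ψ (ρ (((Q v : ℂ))⁻¹ • ιr Q v) φ)) ↔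
        S.Pos (1 * (Q v)⁻¹) v ∨ S.Pos (-1 * (Q v)⁻¹) v := by
    intro v
    rw [← hposdef, ← hnegdef]
    simp only [Complex.ofReal_one, one_mul]
    rfl
  have hcone : HasSignature Q 1 (Module.finrank ℝ V - 1) →
      (∃ v, 0 < Q v) ∧ ∀ v, 0 < Q v → S.Pos 1 v ∨ S.Pos (-1) v := by
    intro hsig
    obtain ⟨e, hQe, l, hl, he⟩ :=
      SymmCliffordAction.exists_pos_of_hasSignature (S := S) hirr.eq_bot_or_top hnd hsig
    refine ⟨⟨e, by rw [hQe]; exact one_pos⟩, fun v hv => ?_⟩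
    rcases hl with rfl | rfl
    · exact he.pos_or_neg hQe hv
    · simpa using (he.pos_or_neg hQe hv).symm
  have hlight : HasSignature Q 1 (Module.finrank ℝ V - 1) → ∀ v : V,
      (FDefinite (fun ψ φ : K => h.form ψ (ρ (((Q v : ℂ))⁻¹ • ιr Q v) φ)) ↔ 0 < Q v) := by
    intro hsig v
    rw [hdefinite]
    constructor
    · rintro (hv | hv) <;> exact hv.quadratic_pos
    · intro hv
      rw [hscale _ _ hv, hscale _ _ hv]
      exact (hcone hsig).2 v hv
  refine ⟨⟨fun hsig => ?_, ?_⟩, fun hsig => ⟨fun v _ => hlight hsig v, ?_⟩⟩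
  · obtain ⟨v, hv⟩ := (hcone hsig).1
    exact ⟨v, hv.ne', (hlight hsig v).2 hv⟩
  · rintro ⟨v, -, hv⟩
    rcases (hdefinite v).1 hv with hv | hv <;> exact hv.hasSignature hQ
  · rintro Cp Cn ⟨hunion, hdisj, ⟨vp, hvp⟩, ⟨vn, hvn⟩, hpp, hnn, hpn⟩
    have hC : ∀ v, 0 < Q v ↔ v ∈ Cp ∨ v ∈ Cn := fun v => by
      rw [← Set.mem_union, hunion, Set.mem_ofPred_eq]
    have hd := (hcone hsig).2
    obtain ⟨l, hl, hlp⟩ : ∃ l : ℝ, (l = 1 ∨ l = -1) ∧ S.Pos l vp := by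
      rcases hd vp ((hC vp).2 (Or.inl hvp)) with h1 | h1
      · exact ⟨1, Or.inl rfl, h1⟩
      · exact ⟨-1, Or.inr rfl, h1⟩
    have hdl : ∀ v, 0 < Q v → S.Pos l v ∨ S.Pos (-l) v := by
      rcases hl with rfl | rfl
      · exact hd
      · intro v hv; simpa using (hd v hv).symm
    have hdl' : ∀ v, 0 < Q v → S.Pos (-l) v ∨ S.Pos (- -l) v := fun v hv => by
      simpa using (hdl v hv).symm
    have hln : S.Pos (-l) vn := (hdl vn ((hC vn).2 (Or.inr hvn))).resolve_left
      fun h1 => hpn vp hvp vn hvn (hlp.sameConePos h1)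
    have hP : ∀ v ∈ Cp, S.Pos l v := fun v hv => hlp.of_sameConePos hdl (hpp vp hvp v hv)
    have hN : ∀ v ∈ Cn, S.Pos (-l) v := fun v hv => hln.of_sameConePos hdl' (hnn vn hvn v hv)
    refine ⟨l, hl, fun v hv => ?_⟩
    rw [hposdef, hnegdef, hscale _ _ hv, hscale _ _ hv]
    refine ⟨⟨fun h1 => ?_, hP v⟩, ⟨fun h1 => ?_, hN v⟩⟩
    · exact ((hC v).1 hv).resolve_right fun h2 => h1.not_neg (hN v h2)
    · exact ((hC v).1 hv).resolve_left fun h2 => (hP v h2).not_neg h1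
end
end

section
/- Let σ be a real structure on ℂl(V), let e ∈ ℂl(V) be a primitive idempotent, and let S_e := ℂl(V)e be the associated minimal left ideal (algebraic spinor module), on which ℂl(V) acts irreducibly by left multiplication. (1) If e·e^{×_σ} = 0, then the σ-product vanishes identically on S_e (so it is not a Krein product on S_e). (2) If e·e^{×_σ} ≠ 0, then: (a) there exists a unique primitive idempotent f ∈ ℂl(V) with f^{×_σ} = f and ℂl(V)e = ℂl(V)f; (b) the restriction of the σ-product to S_e is a nondegenerate hermitian form, and the left-multiplication representation of ℂl(V) on S_e is σ-compatible with respect to it, i.e., (a·x, y)_σ = (x, a^{×_σ}·y)_σ for all a ∈ ℂl(V) and x, y ∈ S_e. -/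
noncomputable section

open TensorProduct

variable {V : Type*} [AddCommGroup V] [Module ℝ V]

/-- The σ-product `(a,b)_σ = τ_n(σ(aᵀ)b)` on `ℂl(V)`. -/
def sprod {Q : QuadraticForm ℝ V} (σ : RealStructure Q) (τ : CCl Q →ₗ[ℂ] ℂ)
    (a b : CCl Q) : ℂ :=
  τ (σ.toFun (CliffordAlgebra.reverse a) * b)

/-- A primitive idempotent: a nonzero idempotent which is not the sum of two nonzero
orthogonal idempotents. -/
def IsPrimitiveIdem {Q : QuadraticForm ℝ V} (e : CCl Q) : Prop :=
  e * e = e ∧ e ≠ 0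
  ∧ ¬ ∃ e₁ e₂ : CCl Q, e₁ ≠ 0 ∧ e₂ ≠ 0 ∧ e₁ * e₁ = e₁ ∧ e₂ * e₂ = e₂
      ∧ e₁ * e₂ = 0 ∧ e₂ * e₁ = 0 ∧ e = e₁ + e₂

/-- A family of pairwise anticommuting elements with nonzero scalar squares which generates the
algebra, in the sense that products of the family span it. -/
structure AnticommutingGenerators {A ι : Type*} [Ring A] [Algebra ℂ A] (g : ι → A) (q : ι → ℂ) :
    Prop where
  q_ne : ∀ i, q i ≠ 0
  sq : ∀ i, g i * g i = q i • 1
  anti : ∀ i j, i ≠ j → g i * g j = -(g j * g i)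
  span : Submodule.span ℂ (Set.range fun w : List ι => (w.map g).prod) = ⊤

namespace AnticommutingGenerators

variable {A ι : Type*} [Ring A] [Algebra ℂ A] {g : ι → A} {q : ι → ℂ}

section Words

variable [DecidableEq ι]

theorem mul_word (h : AnticommutingGenerators g q) (i : ι) (w : List ι) :
    g i * (w.map g).prod = (-1 : ℂ) ^ (w.length + w.count i) • ((w.map g).prod * g i) := by
  induction w with
  | nil => simp
  | cons j w ih =>
    rw [List.map_cons, List.prod_cons]
    by_cases hij : j = i
    · subst hij
      rw [List.length_cons, List.count_cons_self, mul_assoc, ih, mul_smul_comm]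
      congr 1
      ring
    · rw [List.length_cons, List.count_cons_of_ne hij, ← mul_assoc, h.anti i j (Ne.symm hij),
        neg_mul, mul_assoc, ih, mul_smul_comm, mul_assoc, ← neg_smul]
      congr 1
      ring

theorem word_eq_smul_one (h : AnticommutingGenerators g q) (w : List ι)
    (hw : ∀ i, Even (w.count i)) : ∃ c : ℂ, c ≠ 0 ∧ (w.map g).prod = c • (1 : A) := by
  induction hn : w.length using Nat.strong_induction_on generalizing w with
  | _ n ih =>
  match w, hw, hn with
  | [], _, _ => exact ⟨1, one_ne_zero, by simp⟩
  | i :: w, hw, hn =>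
    have hi : i ∈ w := by
      have h1 := hw i
      rw [List.count_cons_self] at h1
      by_contra hi
      rw [List.count_eq_zero_of_not_mem hi] at h1
      simp at h1
    obtain ⟨u, v, rfl⟩ := List.append_of_mem hi
    obtain ⟨c, hc, hcw⟩ := ih (u ++ v).length (by simp at hn ⊢; omega) (u ++ v) (by
      intro j
      have h1 := hw j
      simp only [List.count_append, List.count_cons, Nat.even_iff] at h1 ⊢
      split_ifs at h1 <;> omega) rfl
    refine ⟨(-1 : ℂ) ^ (u.length + u.count i) * (q i * c),
      mul_ne_zero (pow_ne_zero _ (by norm_num)) (mul_ne_zero (h.q_ne i) hc), ?_⟩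
    rw [List.map_append, List.prod_append] at hcw
    rw [List.map_cons, List.prod_cons, List.map_append, List.prod_append, List.map_cons,
      List.prod_cons, ← mul_assoc, h.mul_word, smul_mul_assoc, mul_assoc, ← mul_assoc (g i) (g i),
      h.sq, smul_mul_assoc, one_mul, mul_smul_comm, hcw, smul_smul, smul_smul, mul_assoc]

theorem mul_word_of_odd (h : AnticommutingGenerators g q) {i : ι} {w : List ι}
    (hi : Odd (w.length + w.count i)) : g i * (w.map g).prod = -((w.map g).prod * g i) := by
  rw [h.mul_word, hi.neg_one_pow, neg_one_smul]

theorem even_count_or_odd [Fintype ι] (hι : Even (Fintype.card ι)) (w : List ι) :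
    (∀ i, Even (w.count i)) ∨ ∃ i, Odd (w.length + w.count i) := by
  by_cases hw : ∃ i, Odd (w.length + w.count i)
  · exact Or.inr hw
  · left
    push Not at hw
    have hsum : ∑ i, w.count i = w.length := by
      clear hw
      induction w with
      | nil => simp
      | cons j w ih => simp [List.count_cons, Finset.sum_add_distrib, ih]
    have hlen : Even w.length := by
      have h2 : Even (∑ i, (w.length + w.count i)) :=
        Finset.even_sum _ fun i _ => by simpa using hw i
      rw [Finset.sum_add_distrib, hsum, Finset.sum_const, smul_eq_mul] at h2
      exact (Nat.even_add.1 h2).1 (hι.mul_right _)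
    intro i
    exact (Nat.even_add.1 (by simpa using hw i)).1 hlen

end Words

theorem trace_word_eq_zero (h : AnticommutingGenerators g q) {τ : A →ₗ[ℂ] ℂ}
    (hτ : ∀ a b, τ (a * b) = τ (b * a)) {i : ι} {x : A} (hx : g i * x = -(x * g i)) :
    τ x = 0 := by
  have h1 : q i * τ x = -(q i * τ x) := by
    calc q i * τ x = τ (g i * g i * x) := by rw [h.sq]; simp
      _ = -τ (g i * (x * g i)) := by rw [mul_assoc, hx]; simp
      _ = -τ (g i * g i * x) := by rw [← mul_assoc, hτ (g i * x), ← mul_assoc]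
      _ = -(q i * τ x) := by rw [h.sq]; simp
  exact (mul_eq_zero.1 (self_eq_neg.1 h1)).resolve_left (h.q_ne i)

theorem trace_unique [Fintype ι] (h : AnticommutingGenerators g q) (hι : Even (Fintype.card ι))
    {τ τ' : A →ₗ[ℂ] ℂ} (hτ1 : τ 1 = 1) (hτ : ∀ a b, τ (a * b) = τ (b * a))
    (hτ'1 : τ' 1 = 1) (hτ' : ∀ a b, τ' (a * b) = τ' (b * a)) : τ = τ' := by
  classical
  refine LinearMap.ext_on_range h.span fun w => ?_
  rcases even_count_or_odd hι w with hw | ⟨i, hi⟩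
  · obtain ⟨c, -, hc⟩ := h.word_eq_smul_one w hw
    simp [hc, hτ1, hτ'1]
  · rw [h.trace_word_eq_zero hτ (h.mul_word_of_odd hi), h.trace_word_eq_zero hτ' (h.mul_word_of_odd hi)]

section Subsets

variable [DecidableEq ι]

theorem count_toList (s : Finset ι) (i : ι) : s.toList.count i = if i ∈ s then 1 else 0 := by
  simp [s.nodup_toList.count]

theorem span_finset [Fintype ι] (h : AnticommutingGenerators g q) :
    Submodule.span ℂ (Set.range fun s : Finset ι => (s.toList.map g).prod) = ⊤ := by
  rw [eq_top_iff, ← h.span, Submodule.span_le]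
  rintro _ ⟨w, rfl⟩
  set s : Finset ι := {i | Odd (w.count i)} with hs
  obtain ⟨c, hc, hcw⟩ := h.word_eq_smul_one (w ++ s.toList) (by
    intro i
    rw [List.count_append, count_toList]
    by_cases hi : Odd (w.count i)
    · simp [hs, hi, hi.add_odd odd_one]
    · simpa [hs, hi] using Nat.not_odd_iff_even.1 hi)
  obtain ⟨d, hd, hdw⟩ := h.word_eq_smul_one (s.toList ++ s.toList) (by simp)
  have key : d • (w.map g).prod = c • (s.toList.map g).prod := by
    rw [List.map_append, List.prod_append] at hcw hdw
    have := congrArg (· * (s.toList.map g).prod) hcw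
    simpa [mul_assoc, hdw] using this
  have : (w.map g).prod = (d⁻¹ * c) • (s.toList.map g).prod := by
    rw [mul_smul, ← key, inv_smul_smul₀ hd]
  simp only [this]
  exact Submodule.smul_mem _ _ (Submodule.subset_span ⟨s, rfl⟩)

theorem trace_nondegenerate [Fintype ι] (h : AnticommutingGenerators g q) (hι : Even (Fintype.card ι))
    {τ : A →ₗ[ℂ] ℂ} (hτ1 : τ 1 = 1) (hτ : ∀ a b, τ (a * b) = τ (b * a)) {x : A}
    (hx : ∀ y, τ (x * y) = 0) : x = 0 := by
  have hxs : x ∈ Submodule.span ℂ (Set.range fun s : Finset ι => (s.toList.map g).prod) := by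
    rw [h.span_finset]; trivial
  obtain ⟨c, rfl⟩ := (Submodule.mem_span_range_iff_exists_fun ℂ).1 hxs
  refine Finset.sum_eq_zero fun t _ => ?_
  have ht := hx (t.toList.map g).prod
  rw [Finset.sum_mul, map_sum, Finset.sum_eq_single t] at ht
  · obtain ⟨d, hd, hdw⟩ := h.word_eq_smul_one (t.toList ++ t.toList) (by simp)
    rw [List.map_append, List.prod_append] at hdw
    rw [smul_mul_assoc, hdw] at ht
    simp only [map_smul, hτ1, smul_eq_mul, mul_one, mul_eq_zero, hd, or_false] at ht
    rw [ht, zero_smul]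
  · intro s _ hst
    rw [smul_mul_assoc, map_smul, ← List.prod_append, ← List.map_append]
    rcases even_count_or_odd hι (s.toList ++ t.toList) with hw | ⟨i, hi⟩
    · refine absurd (Finset.ext fun i => ?_) hst
      have := hw i
      rw [List.count_append, count_toList, count_toList] at this
      split_ifs at this <;> simp_all
    · rw [h.trace_word_eq_zero hτ (h.mul_word_of_odd hi), smul_zero]
  · simp

end Subsets

theorem finiteDimensional [Fintype ι] (h : AnticommutingGenerators g q) : FiniteDimensional ℂ A := by
  classical
  exact ⟨Submodule.fg_def.2 ⟨_, Set.finite_range _, h.span_finset⟩⟩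

/-- The sum of `x` and of its conjugate by `g i`. -/
def avg (g : ι → A) (q : ι → ℂ) (i : ι) : A →ₗ[ℂ] A :=
  LinearMap.id + (q i)⁻¹ • (LinearMap.mulLeft ℂ (g i) ∘ₗ LinearMap.mulRight ℂ (g i))

/-- The composition of the operators `avg g q i`, for `i` in a list. -/
def avgList (g : ι → A) (q : ι → ℂ) : List ι → A →ₗ[ℂ] A
  | [] => LinearMap.id
  | i :: L => avg g q i ∘ₗ avgList g q L

theorem avg_apply (i : ι) (x : A) : avg g q i x = x + (q i)⁻¹ • (g i * (x * g i)) := by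
  simp [avg]

theorem avg_of_anticomm (h : AnticommutingGenerators g q) {i : ι} {x : A}
    (hx : g i * x = -(x * g i)) : avg g q i x = 0 := by
  rw [avg_apply, ← mul_assoc, hx, neg_mul, mul_assoc, h.sq, mul_smul_comm, mul_one, smul_neg,
    inv_smul_smul₀ (h.q_ne i), add_neg_cancel]

theorem avg_of_comm (h : AnticommutingGenerators g q) {i : ι} {x : A}
    (hx : g i * x = x * g i) : avg g q i x = (2 : ℂ) • x := by
  rw [avg_apply, ← mul_assoc, hx, mul_assoc, h.sq, mul_smul_comm, mul_one,
    inv_smul_smul₀ (h.q_ne i), two_smul]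

theorem avgList_one (h : AnticommutingGenerators g q) (L : List ι) :
    avgList g q L 1 = (2 : ℂ) ^ L.length • (1 : A) := by
  induction L with
  | nil => simp [avgList]
  | cons i L ih =>
    rw [avgList, LinearMap.comp_apply, ih, map_smul, h.avg_of_comm (by simp), smul_smul,
      List.length_cons, pow_succ]

theorem avgList_word [DecidableEq ι] (h : AnticommutingGenerators g q) (L w : List ι) :
    ∃ c : ℂ, avgList g q L (w.map g).prod = c • (w.map g).prod ∧
      ∀ i ∈ L, Odd (w.length + w.count i) → c = 0 := by
  induction L with
  | nil => exact ⟨1, by simp [avgList]⟩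
  | cons j L ih =>
    obtain ⟨c, hc, hc'⟩ := ih
    rw [avgList, LinearMap.comp_apply, hc, map_smul]
    rcases (w.length + w.count j).even_or_odd with hj | hj
    · have hcomm := h.mul_word j w
      rw [hj.neg_one_pow, one_smul] at hcomm
      refine ⟨c * 2, by rw [h.avg_of_comm hcomm, smul_smul], fun i hi hia => ?_⟩
      rcases List.mem_cons.1 hi with rfl | hi
      · exact absurd hj (Nat.not_even_iff_odd.2 hia)
      · rw [hc' i hi hia, zero_mul]
    · exact ⟨0, by rw [h.avg_of_anticomm (h.mul_word_of_odd hj), smul_zero, zero_smul], fun _ _ _ => rfl⟩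

theorem avgList_univ [Fintype ι] (h : AnticommutingGenerators g q) (hι : Even (Fintype.card ι))
    {τ : A →ₗ[ℂ] ℂ} (hτ1 : τ 1 = 1) (hτ : ∀ a b, τ (a * b) = τ (b * a)) (x : A) :
    avgList g q Finset.univ.toList x = ((2 : ℂ) ^ Fintype.card ι * τ x) • (1 : A) := by
  classical
  have : avgList g q Finset.univ.toList
      = ((2 : ℂ) ^ Fintype.card ι • τ).smulRight (1 : A) := by
    refine LinearMap.ext_on_range h.span fun w => ?_
    rcases even_count_or_odd hι w with hw | ⟨i, hi⟩
    · obtain ⟨c, -, hc⟩ := h.word_eq_smul_one w hw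
      simp [hc, hτ1, h.avgList_one, smul_smul]
    · obtain ⟨c, hc, hc'⟩ := h.avgList_word Finset.univ.toList w
      simp [hc, hc' i (by simp) hi, h.trace_word_eq_zero hτ (h.mul_word_of_odd hi)]
  simp [this]

theorem avgList_mem (L : List ι) (I : TwoSidedIdeal A) {x : A} (hx : x ∈ I) :
    avgList g q L x ∈ I := by
  induction L with
  | nil => simpa [avgList] using hx
  | cons i L ih =>
    rw [avgList, LinearMap.comp_apply, avg_apply, Algebra.smul_def]
    exact I.add_mem ih (I.mul_mem_left _ _ (I.mul_mem_left _ _ (I.mul_mem_right _ _ ih)))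

theorem isSimpleRing [Fintype ι] (h : AnticommutingGenerators g q) (hι : Even (Fintype.card ι))
    {τ : A →ₗ[ℂ] ℂ} (hτ1 : τ 1 = 1) (hτ : ∀ a b, τ (a * b) = τ (b * a)) : IsSimpleRing A := by
  classical
  have : Nontrivial A := ⟨1, 0, fun h0 => by simp [h0] at hτ1⟩
  refine IsSimpleRing.of_eq_bot_or_eq_top fun I => or_iff_not_imp_left.2 fun hI => ?_
  obtain ⟨x, hxI, hx⟩ : ∃ x ∈ I, x ≠ 0 := by
    by_contra! hcon
    exact hI (eq_bot_iff.2 fun x hx => (TwoSidedIdeal.mem_bot A).2 (hcon x hx))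
  obtain ⟨y, hy⟩ : ∃ y, τ (x * y) ≠ 0 := by
    by_contra! hcon
    exact hx (h.trace_nondegenerate hι hτ1 hτ hcon)
  have hmem := avgList_mem (g := g) (q := q) Finset.univ.toList I (I.mul_mem_right x y hxI)
  rw [h.avgList_univ hι hτ1 hτ] at hmem
  have hc : (2 : ℂ) ^ Fintype.card ι * τ (x * y) ≠ 0 := mul_ne_zero (by simp) hy
  refine (TwoSidedIdeal.one_mem_iff I).1 ?_
  have := I.mul_mem_left (algebraMap ℂ A ((2 : ℂ) ^ Fintype.card ι * τ (x * y))⁻¹) _ hmem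
  rwa [← Algebra.smul_def, inv_smul_smul₀ hc] at this

end AnticommutingGenerators

section RankOne

open Matrix

/-- An idempotent of a complex matrix algebra with no nontrivial decomposition spans its corner. -/
theorem matrix_corner_of_indecomposable {n : Type*} [Fintype n] [DecidableEq n]
    {E : Matrix n n ℂ} (hE : E * E = E) (hE0 : E ≠ 0)
    (hp : ¬ ∃ e₁ e₂ : Matrix n n ℂ, e₁ ≠ 0 ∧ e₂ ≠ 0 ∧ e₁ * e₁ = e₁ ∧ e₂ * e₂ = e₂
      ∧ e₁ * e₂ = 0 ∧ e₂ * e₁ = 0 ∧ E = e₁ + e₂) (X : Matrix n n ℂ) :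
    ∃ c : ℂ, E * X * E = c • E := by
  obtain ⟨i, j, hij⟩ : ∃ i j, E i j ≠ 0 := by
    by_contra! hcon
    exact hE0 (Matrix.ext hcon)
  set d := E i j with hd
  set S : Matrix n n ℂ := Matrix.single j i d⁻¹ with hS
  have hSES : ∀ Y : Matrix n n ℂ, S * Y * S = (d⁻¹ * Y i j) • S := by
    intro Y
    rw [hS, Matrix.single_mul_mul_single, Matrix.smul_single]
    congr 1
  set F := E * S * E with hF
  have hFF : F * F = F := by
    calc F * F = E * (S * (E * E) * S) * E := by simp only [hF, mul_assoc]
      _ = F := by rw [hE, hSES, ← hd, inv_mul_cancel₀ hij, one_smul]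
  have hEF : E * F = F := by rw [hF, ← mul_assoc, ← mul_assoc, hE]
  have hFE : F * E = F := by rw [hF, mul_assoc, hE]
  have hF0 : F ≠ 0 := by
    intro h0
    have h1 : S * (E * F * E) * S = S := by
      calc S * (E * F * E) * S = (S * (E * E) * S) * (E * E) * S := by simp only [hF, mul_assoc]
        _ = S := by rw [hE, hSES, ← hd, inv_mul_cancel₀ hij, one_smul, hSES, ← hd,
          inv_mul_cancel₀ hij, one_smul]
    rw [h0] at h1
    have h2 := congrFun (congrFun h1 j) i
    simp [hS] at h2
    exact hij h2.symm
  have hEq : E = F := by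
    by_contra hne
    exact hp ⟨F, E - F, hF0, sub_ne_zero.2 hne, hFF,
      by rw [sub_mul, mul_sub, mul_sub, hE, hEF, hFE, hFF]; simp,
      by rw [mul_sub, hFE, hFF, sub_self], by rw [sub_mul, hEF, hFF, sub_self], by simp⟩
  refine ⟨d⁻¹ * (E * X * E) i j, ?_⟩
  calc E * X * E = F * X * F := by rw [← hEq]
    _ = E * (S * (E * X * E) * S) * E := by simp only [hF, mul_assoc]
    _ = _ := by rw [hSES, mul_smul_comm, smul_mul_assoc, ← hF, ← hEq]

theorem corner_of_indecomposable {A : Type*} [Ring A] [Algebra ℂ A] [IsSimpleRing A]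
    [FiniteDimensional ℂ A] {e : A} (he : e * e = e) (he0 : e ≠ 0)
    (hp : ¬ ∃ e₁ e₂ : A, e₁ ≠ 0 ∧ e₂ ≠ 0 ∧ e₁ * e₁ = e₁ ∧ e₂ * e₂ = e₂
      ∧ e₁ * e₂ = 0 ∧ e₂ * e₁ = 0 ∧ e = e₁ + e₂) (x : A) :
    ∃ c : ℂ, e * x * e = c • e := by
  obtain ⟨n, -, ⟨φ⟩⟩ := IsSimpleRing.exists_algEquiv_matrix_of_isAlgClosed ℂ A
  obtain ⟨c, hc⟩ := matrix_corner_of_indecomposable (E := φ e) (by rw [← map_mul, he])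
    (by simpa using he0) (by
      rintro ⟨e₁, e₂, h1, h2, h3, h4, h5, h6, h7⟩
      exact hp ⟨φ.symm e₁, φ.symm e₂, by simpa using h1, by simpa using h2,
        by rw [← map_mul, h3], by rw [← map_mul, h4], by rw [← map_mul, h5, map_zero],
        by rw [← map_mul, h6, map_zero], by rw [← map_add, ← h7, φ.symm_apply_apply]⟩) (φ x)
  exact ⟨c, φ.injective (by simpa using hc)⟩

theorem indecomposable_of_corner {A : Type*} [Ring A] [Algebra ℂ A] {f : A}
    (hf : ∀ x, ∃ c : ℂ, f * x * f = c • f) :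
    ¬ ∃ e₁ e₂ : A, e₁ ≠ 0 ∧ e₂ ≠ 0 ∧ e₁ * e₁ = e₁ ∧ e₂ * e₂ = e₂
      ∧ e₁ * e₂ = 0 ∧ e₂ * e₁ = 0 ∧ f = e₁ + e₂ := by
  rintro ⟨e₁, e₂, h1, h2, h3, h4, h5, h6, rfl⟩
  obtain ⟨c, hc⟩ := hf e₁
  have hc' : e₁ = c • (e₁ + e₂) := by
    rw [← hc, add_mul, h3, h6, add_zero, mul_add, h3, h5, add_zero]
  have h7 : c • e₂ = 0 := by
    have := congrArg (· * e₂) hc'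
    simpa [add_mul, h4, h5] using this.symm
  rcases smul_eq_zero.1 h7 with h0 | h0
  · exact h1 (by rw [hc', h0, zero_smul])
  · exact h2 h0

end RankOne

section StarTrace

variable {A : Type*} [Ring A] [Algebra ℂ A]

theorem existsUnique_selfAdjoint_idempotent {s : A → A}
    (s_mul : ∀ x y, s (x * y) = s y * s x)
    (s_smul : ∀ (z : ℂ) x, s (z • x) = (starRingEnd ℂ z) • s x) (s_invol : ∀ x, s (s x) = x)
    {τ : A →ₗ[ℂ] ℂ} (hτ : ∀ a b, τ (a * b) = τ (b * a))
    (hnd : ∀ x, (∀ y, τ (x * y) = 0) → x = 0) {e : A} (he : e * e = e) (he0 : e ≠ 0)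
    (hcorner : ∀ x, ∃ c : ℂ, e * x * e = c • e) (hes : e * s e ≠ 0) :
    ∃! f : A, (f * f = f ∧ f ≠ 0 ∧ ∀ x, ∃ c : ℂ, f * x * f = c • f) ∧ s f = f ∧
      ∀ x : A, (∃ a, x = a * e) ↔ ∃ a, x = a * f := by
  obtain ⟨a, ha⟩ : ∃ a, e * s e * a * e ≠ 0 := by
    by_contra! hcon
    refine hes (hnd _ fun b => ?_)
    have h1 : τ (e * s e * b) = τ (e * s e * b * e) := by
      rw [hτ (e * s e * b) e]
      simp only [← mul_assoc, he]
    rw [h1, hcon, map_zero]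
  obtain ⟨l, hl⟩ := hcorner (s e * a)
  rw [← mul_assoc] at hl
  have hl0 : l ≠ 0 := by rintro rfl; exact ha (by rw [hl, zero_smul])
  set f := l⁻¹ • (s e * a * e) with hf
  have hef : e * f = e := by
    rw [hf, mul_smul_comm, ← mul_assoc, ← mul_assoc, hl, inv_smul_smul₀ hl0]
  have hfe : f * e = f := by rw [hf, smul_mul_assoc, mul_assoc, he]
  have hff : f * f = f := by
    calc f * f = (f * e) * f := by rw [hfe]
      _ = f := by rw [mul_assoc, hef, hfe]
  have hf0 : f ≠ 0 := by rintro h0; exact he0 (by rw [← hef, h0, mul_zero])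
  have hfc : ∀ x, ∃ c : ℂ, f * x * f = c • f := by
    intro x
    obtain ⟨c, hc⟩ := hcorner (x * f)
    refine ⟨c, ?_⟩
    calc f * x * f = f * (e * (x * f) * e) := by
          rw [mul_assoc (e), mul_assoc x, hfe, ← mul_assoc f e, hfe, mul_assoc]
      _ = c • f := by rw [hc, mul_smul_comm, hfe]
  have hsee : s e * s e = s e := by rw [← s_mul, he]
  have hsef : s e * f = f := by rw [hf, mul_smul_comm, ← mul_assoc, ← mul_assoc, hsee]
  obtain ⟨μ, hμ⟩ : ∃ μ : ℂ, f * s e = μ • s e := by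
    obtain ⟨c, hc⟩ := hcorner (s (s e * a * e))
    refine ⟨l⁻¹ * starRingEnd ℂ c, ?_⟩
    have h1 := congrArg s hc
    rw [s_smul, s_mul, s_mul, s_invol] at h1
    calc f * s e = l⁻¹ • (s e * (s e * a * e * s e)) := by
          rw [hf, smul_mul_assoc]
          simp only [← mul_assoc, hsee]
      _ = _ := by rw [h1, smul_smul]
  have hfse : f * s e = s e := by
    have h1 : μ • f = f := by
      calc μ • f = (μ • s e) * f := by rw [smul_mul_assoc, hsef]
        _ = f := by rw [← hμ, mul_assoc, hsef, hff]
    have h2 : (μ - 1) • f = 0 := by rw [sub_smul, h1, one_smul, sub_self]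
    rw [hμ, sub_eq_zero.1 ((smul_eq_zero.1 h2).resolve_right hf0), one_smul]
  have hfsf : f * s f = s f := by
    have h1 : s f = s e * s f := by rw [← s_mul, hfe]
    rw [h1, ← mul_assoc, hfse]
  have hsf : s f = f := by
    have h1 := congrArg s hfsf
    rw [s_mul, s_invol, hfsf] at h1
    exact h1
  refine ⟨f, ⟨⟨hff, hf0, hfc⟩, hsf, fun x => ⟨?_, ?_⟩⟩, ?_⟩
  · rintro ⟨b, rfl⟩
    exact ⟨b * e, by rw [mul_assoc, hef]⟩
  · rintro ⟨b, rfl⟩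
    exact ⟨b * f, by rw [mul_assoc, hfe]⟩
  · rintro f' ⟨⟨hff', -, -⟩, hsf', heq⟩
    obtain ⟨b, hb⟩ := (heq f').2 ⟨1, (one_mul _).symm⟩
    obtain ⟨b', hb'⟩ := (heq f).1 ⟨f, hfe.symm⟩
    have h1 : f' * f = f' := by rw [hb, mul_assoc, hef]
    have h2 : f * f' = f := by rw [hb', mul_assoc, hff']
    have h3 := congrArg s h1
    rw [s_mul, hsf, hsf', h2] at h3
    exact h3.symm

end StarTrace

section Clifford

open CliffordAlgebra QuadraticMap

theorem exists_anticommutingGenerators [FiniteDimensional ℝ V] (Q : QuadraticForm ℝ V)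
    (hQ : QFNondeg Q) : ∃ (g : Fin (Module.finrank ℝ V) → CCl Q)
      (q : Fin (Module.finrank ℝ V) → ℂ), AnticommutingGenerators g q := by
  have hsymm : (polarBilin Q).IsSymm := ⟨fun x y => polar_comm Q x y⟩
  obtain ⟨v, hv⟩ := LinearMap.BilinForm.exists_orthogonal_basis hsymm
  have hpolar : ∀ i j, i ≠ j → polar Q (v i) (v j) = 0 := fun i j hij => hv hij
  have hsq : ∀ i, ιr Q (v i) * ιr Q (v i) = ((Q (v i) : ℝ) : ℂ) • (1 : CCl Q) := by
    intro i
    rw [ιr, ι_sq_scalar, QuadraticForm.baseChange_tmul, Algebra.algebraMap_eq_smul_one]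
    simp
  have hanti : ∀ i j, i ≠ j → ιr Q (v i) * ιr Q (v j) = -(ιr Q (v j) * ιr Q (v i)) := by
    intro i j hij
    have hadd : Q (v i + v j) = Q (v i) + Q (v j) := by
      have := hpolar i j hij
      rw [polar] at this
      linarith
    rw [eq_neg_iff_add_eq_zero, ιr, ιr, ι_mul_ι_add_swap, polar, ← TensorProduct.tmul_add,
      QuadraticForm.baseChange_tmul, QuadraticForm.baseChange_tmul,
      QuadraticForm.baseChange_tmul, hadd]
    simp
  refine ⟨fun i => ιr Q (v i), fun i => (Q (v i) : ℂ), ?_, hsq, hanti, ?_⟩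
  · intro i hi
    have hi : Q (v i) = 0 := by exact_mod_cast hi
    refine v.ne_zero i (hQ _ fun w => ?_)
    have hz : polarBilin Q (v i) = 0 := by
      refine v.ext fun j => ?_
      rcases eq_or_ne i j with rfl | hij
      · simp [hi]
      · exact hpolar i j hij
    exact LinearMap.congr_fun hz w
  · set W := Submodule.span ℂ
      (Set.range fun w : List (Fin (Module.finrank ℝ V)) => (w.map fun i => ιr Q (v i)).prod)
    have hmul : ∀ x ∈ W, ∀ y ∈ W, x * y ∈ W := by
      intro x hx y hy
      have hxy := Submodule.mul_mem_mul hx hy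
      rw [Submodule.span_mul_span] at hxy
      refine Submodule.span_mono ?_ hxy
      rintro _ ⟨_, ⟨w, rfl⟩, _, ⟨w', rfl⟩, rfl⟩
      exact ⟨w ++ w', by simp⟩
    have hone : (1 : CCl Q) ∈ W := Submodule.subset_span ⟨[], by simp⟩
    refine eq_top_iff.2 fun x _ => ?_
    induction x using CliffordAlgebra.induction with
    | algebraMap r => rw [Algebra.algebraMap_eq_smul_one]; exact W.smul_mem _ hone
    | ι m =>
      have hm : m ∈ Submodule.span ℂ (Set.range (Algebra.TensorProduct.basis ℂ v)) := by
        rw [Module.Basis.span_eq]; trivial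
      induction hm using Submodule.span_induction with
      | mem m hm =>
        obtain ⟨i, rfl⟩ := hm
        exact Submodule.subset_span ⟨[i], by simp [ιr]⟩
      | zero => rw [map_zero]; exact W.zero_mem
      | add m m' _ _ hm hm' => rw [map_add]; exact W.add_mem (hm trivial) (hm' trivial)
      | smul c m _ hm => rw [map_smul]; exact W.smul_mem _ (hm trivial)
    | mul a b ha hb => exact hmul _ (ha trivial) _ (hb trivial)
    | add a b ha hb => exact W.add_mem (ha trivial) (hb trivial)

namespace RealStructure

variable {Q : QuadraticForm ℝ V} (σ : RealStructure Q)

theorem map_algebraMap (z : ℂ) :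
    σ.toFun (algebraMap ℂ (CCl Q) z) = algebraMap ℂ (CCl Q) (starRingEnd ℂ z) := by
  rw [Algebra.algebraMap_eq_smul_one, σ.map_smul', σ.map_one', Algebra.algebraMap_eq_smul_one]

theorem reverse_map (x : CCl Q) : reverse (σ.toFun x) = σ.toFun (reverse x) := by
  induction x using CliffordAlgebra.induction with
  | algebraMap r => rw [map_algebraMap, reverse.commutes, reverse.commutes, map_algebraMap]
  | ι m =>
    obtain ⟨m', hm'⟩ := σ.stable _ ⟨m, rfl⟩
    rw [reverse_ι, ← hm', reverse_ι]
  | mul a b ha hb => rw [σ.map_mul', reverse.map_mul, reverse.map_mul, σ.map_mul', ha, hb]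
  | add a b ha hb => rw [σ.map_add', map_add, map_add, σ.map_add', ha, hb]

/-- The conjugate-linear anti-involution `a ↦ a^{×_σ} = σ(aᵀ)`. -/
def cross (x : CCl Q) : CCl Q := σ.toFun (reverse x)

theorem cross_mul (x y : CCl Q) : σ.cross (x * y) = σ.cross y * σ.cross x := by
  rw [cross, reverse.map_mul, σ.map_mul', cross, cross]

theorem cross_smul (z : ℂ) (x : CCl Q) : σ.cross (z • x) = (starRingEnd ℂ z) • σ.cross x := by
  rw [cross, map_smul, σ.map_smul', cross]

theorem cross_cross (x : CCl Q) : σ.cross (σ.cross x) = x := by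
  rw [cross, cross, reverse_map, σ.invol, reverse_reverse]

/-- The functional `x ↦ conj (τ (x^{×_σ}))`. -/
def conjTrace (τ : CCl Q →ₗ[ℂ] ℂ) : CCl Q →ₗ[ℂ] ℂ where
  toFun x := starRingEnd ℂ (τ (σ.cross x))
  map_add' x y := by simp [cross, σ.map_add']
  map_smul' z x := by simp [cross_smul]

theorem conjTrace_apply (τ : CCl Q →ₗ[ℂ] ℂ) (x : CCl Q) :
    σ.conjTrace τ x = starRingEnd ℂ (τ (σ.cross x)) := rfl

end RealStructure

end Clifford

/-- For a primitive idempotent `e` and the algebraic spinor module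
`S_e = ℂl(V)e`: if `e·e^{×_σ} = 0` the σ-product vanishes on `S_e`; if `e·e^{×_σ} ≠ 0`,
there is a unique primitive idempotent `f` with `f^{×_σ} = f` and `ℂl(V)e = ℂl(V)f`, the
σ-product restricts to a nondegenerate hermitian form on `S_e`, and left multiplication is
σ-compatible with respect to it. -/
theorem statement19 [FiniteDimensional ℝ V] (Q : QuadraticForm ℝ V)
    (hdim : Even (Module.finrank ℝ V)) (hQ : QFNondeg Q)
    (τ : CCl Q →ₗ[ℂ] ℂ) (hτ1 : τ 1 = 1) (hτtr : ∀ a b : CCl Q, τ (a * b) = τ (b * a))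
    (σ : RealStructure Q)
    (e : CCl Q) (he : IsPrimitiveIdem e) :
    -- (1) if e·e^{×_σ} = 0 then the σ-product vanishes on S_e
    ((e * σ.toFun (CliffordAlgebra.reverse e) = 0) →
      ∀ x y : CCl Q, (∃ a, x = a * e) → (∃ b, y = b * e) → sprod σ τ x y = 0)
    -- (2) if e·e^{×_σ} ≠ 0:
    ∧ ((e * σ.toFun (CliffordAlgebra.reverse e) ≠ 0) →
      -- (a) unique primitive idempotent f with f^{×_σ} = f and ℂl(V)e = ℂl(V)f
      (∃! f : CCl Q, IsPrimitiveIdem f ∧ σ.toFun (CliffordAlgebra.reverse f) = f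
          ∧ (∀ x : CCl Q, (∃ a, x = a * e) ↔ (∃ a, x = a * f)))
      -- (b) the σ-product restricts to a (hermitian) nondegenerate form on S_e …
      ∧ (∀ x y : CCl Q, (∃ a, x = a * e) → (∃ b, y = b * e) →
          sprod σ τ y x = starRingEnd ℂ (sprod σ τ x y))
      ∧ (∀ x : CCl Q, (∃ a, x = a * e) →
          (∀ y : CCl Q, (∃ b, y = b * e) → sprod σ τ x y = 0) → x = 0)
      -- … and left multiplication by ℂl(V) is σ-compatible for it
      ∧ (∀ (a x y : CCl Q), (∃ a', x = a' * e) → (∃ b', y = b' * e) →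
          sprod σ τ (a * x) y
            = sprod σ τ x (σ.toFun (CliffordAlgebra.reverse a) * y))) := by
  obtain ⟨g, q, hg⟩ := exists_anticommutingGenerators Q hQ
  have hcard : Even (Fintype.card (Fin (Module.finrank ℝ V))) := by simpa using hdim
  have := hg.finiteDimensional
  have := hg.isSimpleRing hcard hτ1 hτtr
  have hnd : ∀ x : CCl Q, (∀ y, τ (x * y) = 0) → x = 0 := fun x =>
    hg.trace_nondegenerate hcard hτ1 hτtr
  have hconj : ∀ x, starRingEnd ℂ (τ (σ.cross x)) = τ x := by
    intro x
    have h := hg.trace_unique hcard (τ := σ.conjTrace τ) (τ' := τ)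
      (by simp [RealStructure.conjTrace_apply, RealStructure.cross, σ.map_one', hτ1])
      (fun a b => by
        rw [σ.conjTrace_apply, σ.conjTrace_apply, σ.cross_mul, σ.cross_mul, hτtr]) hτ1 hτtr
    exact LinearMap.congr_fun h x
  have hsprod : ∀ a b, sprod σ τ a b = τ (σ.cross a * b) := fun _ _ => rfl
  obtain ⟨hee, he0, hprim⟩ := he
  have hcorner := corner_of_indecomposable hee he0 hprim
  refine ⟨?_, fun hes => ?_⟩
  · rintro hes _ _ ⟨a, rfl⟩ ⟨b, rfl⟩
    change e * σ.cross e = 0 at hes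
    rw [hsprod, σ.cross_mul, mul_assoc, hτtr]
    have h0 : σ.cross a * (b * e) * σ.cross e = 0 := by
      rw [mul_assoc, mul_assoc, hes, mul_zero, mul_zero]
    rw [h0, map_zero]
  · obtain ⟨f, ⟨⟨hff, hf0, hfc⟩, hsf, hef⟩, huniq⟩ :=
      existsUnique_selfAdjoint_idempotent σ.cross_mul σ.cross_smul σ.cross_cross hτtr hnd
        hee he0 hcorner hes
    refine ⟨⟨f, ⟨⟨hff, hf0, indecomposable_of_corner hfc⟩, hsf, hef⟩, ?_⟩, ?_, ?_, ?_⟩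
    · rintro f' ⟨⟨hff', hf0', hfp'⟩, hsf', hef'⟩
      exact huniq f' ⟨⟨hff', hf0', corner_of_indecomposable hff' hf0' hfp'⟩, hsf', hef'⟩
    · intro x y _ _
      rw [hsprod, hsprod, ← hconj, σ.cross_mul, σ.cross_cross]
    · intro x hx hxy
      obtain ⟨b, rfl⟩ := (hef x).1 hx
      have h0 : σ.cross (b * f) = 0 := by
        refine hnd _ fun y => ?_
        have h1 := hxy (y * f) ((hef _).2 ⟨y, rfl⟩)
        rw [hsprod, ← mul_assoc, hτtr, σ.cross_mul, hsf, ← mul_assoc, ← mul_assoc, hff] at h1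
        rw [σ.cross_mul, hsf, h1]
      have h2 : σ.cross (0 : CCl Q) = 0 := by
        rw [RealStructure.cross, map_zero, σ.map_zero']
      rw [← σ.cross_cross (b * f), h0, h2]
    · intro a x y _ _
      rw [hsprod, hsprod, σ.cross_mul, mul_assoc]
      rfl
end
end
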